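/- A sequentially compact fuzzy metric space (X,M,*) is complete, i.e. every Cauchy sequence in X converges in (X,τ_M). -/

import Mathlib

open Filter Topology Set

/-- A fuzzy metric space in the sense of George and Veeramani: a continuous
t-norm `star` on `[0,1]` together with a fuzzy set `M` on `X × X × (0,∞)`. -/
structure FuzzyMetric (X : Type*) where
  M : X → X → ℝ → ℝ
  star : ℝ → ℝ → ℝ
  star_mem : ∀ a ∈ Set.Icc (0:ℝ) 1, ∀ b ∈ Set.Icc (0:ℝ) 1, star a b ∈ Set.Icc (0:ℝ) 1
  star_comm : ∀ a ∈ Set.Icc (0:ℝ) 1, ∀ b ∈ Set.Icc (0:ℝ) 1, star a b = star b a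
  star_assoc : ∀ a ∈ Set.Icc (0:ℝ) 1, ∀ b ∈ Set.Icc (0:ℝ) 1, ∀ c ∈ Set.Icc (0:ℝ) 1,
    star (star a b) c = star a (star b c)
  star_one : ∀ a ∈ Set.Icc (0:ℝ) 1, star a 1 = a
  star_mono : ∀ a b c d : ℝ, a ∈ Set.Icc (0:ℝ) 1 → b ∈ Set.Icc (0:ℝ) 1 →
    c ∈ Set.Icc (0:ℝ) 1 → d ∈ Set.Icc (0:ℝ) 1 → a ≤ b → c ≤ d → star a c ≤ star b d
  star_continuous : ContinuousOn (fun p : ℝ × ℝ => star p.1 p.2)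
    (Set.Icc (0:ℝ) 1 ×ˢ Set.Icc (0:ℝ) 1)
  M_pos : ∀ x y t, 0 < t → 0 < M x y t
  M_le_one : ∀ x y t, 0 < t → M x y t ≤ 1
  M_eq_one_iff : ∀ x y t, 0 < t → (M x y t = 1 ↔ x = y)
  M_symm : ∀ x y t, 0 < t → M x y t = M y x t
  M_triangle : ∀ x y z t s, 0 < t → 0 < s → star (M x y t) (M y z s) ≤ M x z (t + s)
  M_continuousOn : ∀ x y, ContinuousOn (M x y) (Set.Ioi (0:ℝ))

namespace FuzzyMetric

variable {X : Type*}

/-- The open ball `B(x,r,t)`. -/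
def ball (F : FuzzyMetric X) (x : X) (r t : ℝ) : Set X := {y | 1 - r < F.M x y t}

/-- The topology `τ_M` induced by the fuzzy metric (the balls form a base for it). -/
def topology (F : FuzzyMetric X) : TopologicalSpace X :=
  TopologicalSpace.generateFrom
    {s | ∃ x : X, ∃ r t : ℝ, r ∈ Set.Ioo (0:ℝ) 1 ∧ 0 < t ∧ s = F.ball x r t}

/-- `f : X → ℝ` is `ℝ`-uniformly continuous. -/
def RUniformlyContinuous (F : FuzzyMetric X) (f : X → ℝ) : Prop :=
  ∀ ε > (0:ℝ), ∃ r ∈ Set.Ioo (0:ℝ) 1, ∃ s > (0:ℝ),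
    ∀ x y : X, 1 - r < F.M x y s → |f x - f y| < ε

/-- The Lebesgue property: every open cover is refined by the family of balls of
some fixed radius `r` and parameter `t`. -/
def Lebesgue (F : FuzzyMetric X) : Prop :=
  ∀ 𝒢 : Set (Set X), (∀ G ∈ 𝒢, F.topology.IsOpen G) → ⋃₀ 𝒢 = Set.univ →
    ∃ r ∈ Set.Ioo (0:ℝ) 1, ∃ t > (0:ℝ), ∀ x : X, ∃ G ∈ 𝒢, F.ball x r t ⊆ G

/-- A set `A ⊆ X` is fuzzy uniformly discrete. -/
def UniformlyDiscrete (F : FuzzyMetric X) (A : Set X) : Prop :=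
  ∃ r ∈ Set.Ioo (0:ℝ) 1, ∃ s > (0:ℝ), ∀ x ∈ A, ∀ y ∈ A, x ≠ y → F.M x y s < 1 - r

/-- The set `X'` of accumulation points of `(X, τ_M)`. -/
def derivedSet (F : FuzzyMetric X) : Set X :=
  {x | ∀ U : Set X, F.topology.IsOpen U → x ∈ U → ∃ y ∈ U, y ≠ x}

/-- A sequence is Cauchy in the fuzzy metric. -/
def IsCauchy (F : FuzzyMetric X) (u : ℕ → X) : Prop :=
  ∀ ε ∈ Set.Ioo (0:ℝ) 1, ∀ t > (0:ℝ), ∃ k : ℕ, ∀ m ≥ k, ∀ n ≥ k, 1 - ε < F.M (u m) (u n) t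

/-- Sequential compactness: every sequence has a convergent subsequence. -/
def SeqCompact (F : FuzzyMetric X) : Prop :=
  ∀ u : ℕ → X, ∃ x : X, ∃ φ : ℕ → ℕ, StrictMono φ ∧
    Filter.Tendsto (u ∘ φ) Filter.atTop (@nhds X F.topology x)

end FuzzyMetric
namespace FuzzyMetric

variable {X : Type*} (F : FuzzyMetric X)

theorem M_mem_Icc (x y : X) {t : ℝ} (ht : 0 < t) : F.M x y t ∈ Set.Icc (0:ℝ) 1 :=
  ⟨(F.M_pos x y t ht).le, F.M_le_one x y t ht⟩

theorem exists_lt_star {a c : ℝ} (ha : a ∈ Set.Icc (0:ℝ) 1) (hc : c < a) :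
    ∃ ε ∈ Set.Ioo (0:ℝ) 1, ∀ b ∈ Set.Icc (0:ℝ) 1, 1 - ε < b → c < F.star a b := by
  have hcont : ContinuousOn (fun b : ℝ => F.star a b) (Set.Icc 0 1) :=
    F.star_continuous.comp (f := fun b : ℝ => (a, b)) (by fun_prop) fun b hb => ⟨ha, hb⟩
  have hev := (hcont 1 ⟨zero_le_one, le_rfl⟩).eventually
    (lt_mem_nhds (show c < F.star a 1 by rwa [F.star_one a ha]))
  obtain ⟨δ, hδ, hball⟩ := Metric.eventually_nhds_iff.mp (eventually_nhdsWithin_iff.mp hev)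
  refine ⟨min δ (1 / 2), ⟨by positivity, by linarith [min_le_right δ (1 / 2)]⟩,
    fun b hb hlt => hball ?_ hb⟩
  rw [Real.dist_eq, abs_sub_comm, abs_of_nonneg (by linarith [hb.2])]
  linarith [min_le_left δ (1 / 2)]

theorem exists_lt_M_of_lt {x y : X} {c t : ℝ} (ht : 0 < t) (h : c < F.M x y t) :
    ∃ s ∈ Set.Ioo 0 t, c < F.M x y s := by
  have hev : ∀ᶠ s in 𝓝[<] t, c < F.M x y s :=
    (((F.M_continuousOn x y).continuousAt (Ioi_mem_nhds ht)).eventually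
      (lt_mem_nhds h)).filter_mono nhdsWithin_le_nhds
  obtain ⟨s, hs, hst⟩ := (hev.and (Ioo_mem_nhdsLT ht)).exists
  exact ⟨s, hst, hs⟩

theorem mem_ball_self (x : X) {r t : ℝ} (hr : 0 < r) (ht : 0 < t) : x ∈ F.ball x r t := by
  have := (F.M_eq_one_iff x x t ht).mpr rfl
  simp only [ball, Set.mem_ofPred_eq, this]
  linarith

theorem ball_mem_nhds (x : X) {r t : ℝ} (hr : r ∈ Set.Ioo (0:ℝ) 1) (ht : 0 < t) :
    F.ball x r t ∈ @nhds X F.topology x :=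
  @IsOpen.mem_nhds X F.topology x _
    (TopologicalSpace.isOpen_generateFrom_of_mem ⟨x, r, t, hr, ht, rfl⟩)
    (F.mem_ball_self x hr.1 ht)

theorem tendsto_nhds_of_eventually_ball {ι : Type*} {l : Filter ι} {u : ι → X} {x : X}
    (h : ∀ r ∈ Set.Ioo (0:ℝ) 1, ∀ t > (0:ℝ), ∀ᶠ n in l, u n ∈ F.ball x r t) :
    Tendsto u l (@nhds X F.topology x) := by
  refine TopologicalSpace.tendsto_nhds_generateFrom_iff.mpr ?_
  rintro _ ⟨y, r, t, -, ht, rfl⟩ hx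
  obtain ⟨s, ⟨hs, hst⟩, hxs⟩ := F.exists_lt_M_of_lt ht hx
  obtain ⟨ε, hε, hstar⟩ := F.exists_lt_star (F.M_mem_Icc y x hs) hxs
  filter_upwards [h ε hε (t - s) (sub_pos.mpr hst)] with n hn
  have htri := F.M_triangle y x (u n) s (t - s) hs (sub_pos.mpr hst)
  rw [add_sub_cancel] at htri
  exact (hstar _ (F.M_mem_Icc x (u n) (sub_pos.mpr hst)) hn).trans_le htri

theorem IsCauchy.tendsto_of_subseq {F : FuzzyMetric X} {u : ℕ → X} (hu : F.IsCauchy u)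
    {φ : ℕ → ℕ} (hφ : StrictMono φ) {x : X}
    (hx : Tendsto (u ∘ φ) atTop (@nhds X F.topology x)) :
    Tendsto u atTop (@nhds X F.topology x) := by
  refine F.tendsto_nhds_of_eventually_ball fun r hr t ht => ?_
  have ha : 1 - r / 2 ∈ Set.Icc (0:ℝ) 1 := ⟨by linarith [hr.2], by linarith [hr.1]⟩
  obtain ⟨ε, hε, hstar⟩ := F.exists_lt_star ha (show 1 - r < 1 - r / 2 by linarith [hr.1])
  obtain ⟨k, hk⟩ := hu ε hε (t / 2) (half_pos ht)
  have hball := hx.eventually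
    (F.ball_mem_nhds x (r := r / 2) ⟨half_pos hr.1, by linarith [hr.1, hr.2]⟩ (half_pos ht))
  obtain ⟨m, hm, hkm⟩ := (hball.and (eventually_ge_atTop k)).exists
  filter_upwards [eventually_ge_atTop k] with n hn
  have htri := F.M_triangle x (u (φ m)) (u n) (t / 2) (t / 2) (half_pos ht) (half_pos ht)
  rw [add_halves] at htri
  have hb := F.M_mem_Icc (u (φ m)) (u n) (half_pos ht)
  exact (hstar _ hb (hk _ (hkm.trans (hφ.id_le m)) _ hn)).trans_le
    ((F.star_mono _ _ _ _ ha (F.M_mem_Icc x _ (half_pos ht)) hb hb hm.le le_rfl).trans htri)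

end FuzzyMetric

/-- A sequentially compact fuzzy metric space is complete: every Cauchy sequence
converges in `(X, τ_M)`. -/
theorem seqCompact_complete {X : Type*} [Nonempty X] (F : FuzzyMetric X)
    (h : F.SeqCompact) :
    ∀ u : ℕ → X, F.IsCauchy u → ∃ x : X, Filter.Tendsto u Filter.atTop (@nhds X F.topology x) := by
  intro u hu
  obtain ⟨x, φ, hφ, hx⟩ := h u
  exact ⟨x, hu.tendsto_of_subseq hφ hx⟩
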